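/- arXiv:math/0306084 — 6 statements merged into one kernel-verified Lean document; each statement's English description precedes it below -/
import Mathlib

section
/- (Proposition 2, relation rt-4: exchange of annihilation generators with the dressed transmission matrix.) With t(k) = L(k)T(k)L(k)⁻¹, for all k₁,k₂ ∈ ℝ and all indices i,j,l ∈ {1,…,n}: a_i(k₁) t_{jl}(k₂) = Σ_{q,r,s,m} [S₂₁(k₂,k₁)]^{(i,j)}_{(r,q)} t_{qs}(k₂) [S₁₂(k₁,k₂)]^{(r,s)}_{(m,l)} a_m(k₁). -/
open scoped Matrix BigOperators

variable {n : ℕ}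

/-- `[S₂₁(k₂,k₁)]^{(i,j)}_{(p,q)} = [S(k₂,k₁)]^{(j,i)}_{(q,p)}`. -/
def S21 (S : ℝ → ℝ → Matrix (Fin n × Fin n) (Fin n × Fin n) ℂ) (k₂ k₁ : ℝ) :
    Matrix (Fin n × Fin n) (Fin n × Fin n) ℂ :=
  Matrix.of fun x y => S k₂ k₁ (x.2, x.1) (y.2, y.1)

/-- `M₁ = M ⊗ Iₙ`. -/
def leg1 {A : Type*} [Semiring A] [DecidableEq (Fin n)]
    (M : Matrix (Fin n) (Fin n) A) :
    Matrix (Fin n × Fin n) (Fin n × Fin n) A :=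
  Matrix.of fun x y => if x.2 = y.2 then M x.1 y.1 else 0

/-- `M₂ = Iₙ ⊗ M`. -/
def leg2 {A : Type*} [Semiring A] [DecidableEq (Fin n)]
    (M : Matrix (Fin n) (Fin n) A) :
    Matrix (Fin n × Fin n) (Fin n × Fin n) A :=
  Matrix.of fun x y => if x.1 = y.1 then M x.2 y.2 else 0

/-- entrywise embedding of a scalar `n² × n²` matrix into matrices over `𝒜`. -/
def emb (𝒜 : Type*) [Ring 𝒜] [Algebra ℂ 𝒜]
    (M : Matrix (Fin n × Fin n) (Fin n × Fin n) ℂ) :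
    Matrix (Fin n × Fin n) (Fin n × Fin n) 𝒜 :=
  M.map (algebraMap ℂ 𝒜)

/-- entrywise embedding of a scalar `n × n` matrix into matrices over `𝒜`. -/
def embn (𝒜 : Type*) [Ring 𝒜] [Algebra ℂ 𝒜] (M : Matrix (Fin n) (Fin n) ℂ) :
    Matrix (Fin n) (Fin n) 𝒜 :=
  M.map (algebraMap ℂ 𝒜)

/-- `W₁₂` acting on factors 1,2 of `(ℂⁿ)^{⊗3}`. -/
def leg12 (W : Matrix (Fin n × Fin n) (Fin n × Fin n) ℂ) :
    Matrix (Fin n × Fin n × Fin n) (Fin n × Fin n × Fin n) ℂ :=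
  Matrix.of fun x y => if x.2.2 = y.2.2 then W (x.1, x.2.1) (y.1, y.2.1) else 0

/-- `W₁₃` acting on factors 1,3 of `(ℂⁿ)^{⊗3}`. -/
def leg13 (W : Matrix (Fin n × Fin n) (Fin n × Fin n) ℂ) :
    Matrix (Fin n × Fin n × Fin n) (Fin n × Fin n × Fin n) ℂ :=
  Matrix.of fun x y => if x.2.1 = y.2.1 then W (x.1, x.2.2) (y.1, y.2.2) else 0

/-- `W₂₃` acting on factors 2,3 of `(ℂⁿ)^{⊗3}`. -/
def leg23 (W : Matrix (Fin n × Fin n) (Fin n × Fin n) ℂ) :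
    Matrix (Fin n × Fin n × Fin n) (Fin n × Fin n × Fin n) ℂ :=
  Matrix.of fun x y => if x.1 = y.1 then W (x.2.1, x.2.2) (y.2.1, y.2.2) else 0

lemma sum_sum_comm_sum_sum {ι V : Type*} [Fintype ι] [AddCommMonoid V] (f : ι → ι → ι → ι → V) :
    ∑ a, ∑ b, ∑ c, ∑ d, f a b c d = ∑ c, ∑ d, ∑ a, ∑ b, f a b c d := by
  simpa only [Fintype.sum_prod_type] using
    Finset.sum_comm (s := Finset.univ) (t := Finset.univ)
      (f := fun x y : ι × ι => f x.1 x.2 y.1 y.2)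

/-- A linear relation `X = M Y` between module-valued vectors is inverted by a left inverse
of `M`. -/
lemma eq_sum_smul_of_left_inverse {ι R V : Type*} [Fintype ι] [DecidableEq ι] [Semiring R]
    [AddCommMonoid V] [Module R V] {M N : Matrix ι ι R} (hNM : N * M = 1) {X Y : ι → V}
    (hX : ∀ x, X x = ∑ y, M x y • Y y) (x : ι) : Y x = ∑ y, N x y • X y := by
  calc Y x = ∑ z, (N * M) x z • Y z := by simp [hNM, Matrix.one_apply]
    _ = ∑ z, ∑ y, (N x y * M y z) • Y z := by simp only [Matrix.mul_apply, Finset.sum_smul]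
    _ = ∑ y, N x y • X y := by
      rw [Finset.sum_comm]
      simp only [hX, Finset.smul_sum, mul_smul]

section Exchange

variable {𝒜 : Type*} [Ring 𝒜] [Algebra ℂ 𝒜] {v : Fin n → 𝒜} {L Linv : Matrix (Fin n) (Fin n) 𝒜}
  {M N : Matrix (Fin n × Fin n) (Fin n × Fin n) ℂ}

/-- Moving a vector past the entries of `L` with the inverse exchange matrix. -/
lemma vector_mul_entry_of_exchange (hNM : N * M = 1)
    (h : ∀ i l j, L i l * v j = ∑ p, ∑ q, M (j, i) (q, p) • (v q * L p l)) (i j l : Fin n) :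
    v i * L j l = ∑ r, ∑ q, N (i, j) (r, q) • (L q l * v r) := by
  have key := eq_sum_smul_of_left_inverse hNM (X := fun x : Fin n × Fin n => L x.2 l * v x.1)
    (Y := fun x => v x.1 * L x.2 l)
    (fun x => by rw [h, Finset.sum_comm, Fintype.sum_prod_type]) (i, j)
  rwa [Fintype.sum_prod_type] at key

/-- Moving a vector past the entries of the inverse of `L`. -/
lemma vector_mul_inv_entry_of_exchange (hl : L * Linv = 1) (hr : Linv * L = 1)
    (h : ∀ i l j, L i l * v j = ∑ p, ∑ q, M (j, i) (q, p) • (v q * L p l)) (r y l : Fin n) :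
    v r * Linv y l = ∑ s, ∑ m, M (r, s) (m, l) • (Linv y s * v m) := by
  have hl' : ∀ p, ∑ x, L p x * Linv x l = if p = l then 1 else 0 := fun p => by
    rw [← Matrix.mul_apply, hl, Matrix.one_apply]
  have hr' : ∀ x, ∑ s, Linv y s * L s x = if y = x then 1 else 0 := fun x => by
    rw [← Matrix.mul_apply, hr, Matrix.one_apply]
  calc v r * Linv y l = ∑ x, (∑ s, Linv y s * L s x) * v r * Linv x l := by simp [hr']
    _ = ∑ s, Linv y s * ∑ x, (L s x * v r) * Linv x l := by
      simp only [Finset.sum_mul, Finset.mul_sum, mul_assoc]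
      rw [Finset.sum_comm]
    _ = ∑ s, Linv y s * ∑ p, ∑ m, M (r, s) (m, p) • (v m * ∑ x, L p x * Linv x l) := by
      refine Finset.sum_congr rfl fun s _ => congrArg _ ?_
      simp only [h, Finset.sum_mul, Finset.mul_sum, Finset.smul_sum, smul_mul_assoc, mul_assoc]
      rw [Finset.sum_comm]
      exact Finset.sum_congr rfl fun p _ => Finset.sum_comm
    _ = ∑ s, ∑ m, M (r, s) (m, l) • (Linv y s * v m) := by
      refine Finset.sum_congr rfl fun s _ => ?_
      rw [Finset.sum_comm]
      simp [hl', Finset.mul_sum]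

/-- Exchange of a vector with the dressed matrix `L T L⁻¹`. -/
lemma vector_mul_dressed_entry (hl : L * Linv = 1) (hr : Linv * L = 1) (hNM : N * M = 1)
    (h : ∀ i l j, L i l * v j = ∑ p, ∑ q, M (j, i) (q, p) • (v q * L p l))
    (T : Matrix (Fin n) (Fin n) ℂ) (i j l : Fin n) :
    v i * (L * embn 𝒜 T * Linv) j l = ∑ q, ∑ r, ∑ s, ∑ m,
      (N (i, j) (r, q) * M (r, s) (m, l)) • ((L * embn 𝒜 T * Linv) q s * v m) := by
  have expand : ∀ q s, (L * embn 𝒜 T * Linv) q s = ∑ y, ∑ x, T x y • (L q x * Linv y s) := by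
    intro q s
    simp only [Matrix.mul_apply, embn, Matrix.map_apply, Finset.sum_mul]
    refine Finset.sum_congr rfl fun y _ => Finset.sum_congr rfl fun x _ => ?_
    rw [← Algebra.commutes, ← Algebra.smul_def, smul_mul_assoc]
  have inner : ∀ q r, ∑ y, ∑ x, T x y • (L q x * (v r * Linv y l)) =
      ∑ s, ∑ m, M (r, s) (m, l) • ((L * embn 𝒜 T * Linv) q s * v m) := by
    intro q r
    simp only [vector_mul_inv_entry_of_exchange hl hr h, expand, Finset.sum_mul, Finset.mul_sum,
      Finset.smul_sum, mul_smul_comm, smul_mul_assoc, mul_assoc]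
    rw [sum_sum_comm_sum_sum]
    simp only [smul_comm (T _ _)]
  calc v i * (L * embn 𝒜 T * Linv) j l
      = ∑ y, ∑ x, T x y • (v i * L j x * Linv y l) := by
        simp only [expand, Finset.mul_sum, mul_smul_comm, mul_assoc]
    _ = ∑ q, ∑ r, N (i, j) (r, q) • ∑ y, ∑ x, T x y • (L q x * (v r * Linv y l)) := by
        conv_rhs => rw [Finset.sum_comm]
        simp only [vector_mul_entry_of_exchange hNM h, Finset.sum_mul, Finset.smul_sum,
          smul_mul_assoc, mul_assoc]
        rw [sum_sum_comm_sum_sum]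
        simp only [smul_comm (T _ _)]
    _ = _ := by simp only [inner, Finset.smul_sum, mul_smul]

end Exchange

theorem stmt_0
    (hn : 1 ≤ n)
    (S : ℝ → ℝ → Matrix (Fin n × Fin n) (Fin n × Fin n) ℂ)
    (hU : ∀ k₁ k₂, S k₁ k₂ * S21 S k₂ k₁ = 1)
    (hYB : ∀ k₁ k₂ k₃,
      leg12 (S k₁ k₂) * leg13 (S k₁ k₃) * leg23 (S k₂ k₃) =
        leg23 (S k₂ k₃) * leg13 (S k₁ k₃) * leg12 (S k₁ k₂))
    (T R : ℝ → Matrix (Fin n) (Fin n) ℂ)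
    (hT : ∀ k, (T k)ᴴ = T k)
    (hR : ∀ k, (R k)ᴴ = R (-k))
    (hTRu : ∀ k, T k * T k + R k * R (-k) = 1)
    (hTRz : ∀ k, T k * R k + R k * T (-k) = 0)
    (hbYB : ∀ k₁ k₂,
      S k₁ k₂ * leg1 (R k₁) * S21 S k₂ (-k₁) * leg2 (R k₂) =
        leg2 (R k₂) * S k₁ (-k₂) * leg1 (R k₁) * S21 S (-k₂) (-k₁))
    (htYB : ∀ k₁ k₂,
      S k₁ k₂ * leg1 (T k₁) * S21 S k₂ k₁ * leg2 (T k₂) =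
        leg2 (T k₂) * S k₁ k₂ * leg1 (T k₁) * S21 S k₂ k₁)
    (hrtYB : ∀ k₁ k₂,
      S k₁ k₂ * leg1 (T k₁) * S21 S k₂ k₁ * leg2 (R k₂) =
        leg2 (R k₂) * S k₁ (-k₂) * leg1 (T k₁) * S21 S (-k₂) k₁)
    (𝒜 : Type*) [Ring 𝒜] [Algebra ℂ 𝒜]
    (a ad : ℝ → Fin n → 𝒜)
    (L Linv : ℝ → Matrix (Fin n) (Fin n) 𝒜)
    (hL : ∀ k, L k * Linv k = 1 ∧ Linv k * L k = 1)
    (hZF1 : ∀ k₁ k₂ (i j : Fin n), a k₁ i * a k₂ j =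
      ∑ p, ∑ q, S21 S k₂ k₁ (i, j) (p, q) • (a k₂ q * a k₁ p))
    (hZF2 : ∀ k₁ k₂ (i j : Fin n), ad k₁ i * ad k₂ j =
      ∑ p, ∑ q, S21 S k₂ k₁ (p, q) (i, j) • (ad k₂ q * ad k₁ p))
    (hWB1 : ∀ k₁ k₂ (i l j : Fin n), L k₁ i l * a k₂ j =
      ∑ p, ∑ q, S21 S k₂ k₁ (i, j) (p, q) • (a k₂ q * L k₁ p l))
    (hWB2 : ∀ k₁ k₂ (i l j : Fin n), L k₁ i l * ad k₂ j =
      ∑ p, ∑ q, S k₁ k₂ (i, p) (q, j) • (ad k₂ p * L k₁ q l))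
    (hRLL : ∀ k₁ k₂,
      emb 𝒜 (S k₁ k₂) * leg1 (L k₁) * leg2 (L k₂) =
        leg2 (L k₂) * leg1 (L k₁) * emb 𝒜 (S k₁ k₂))
    (t r : ℝ → Matrix (Fin n) (Fin n) 𝒜)
    (ht : ∀ k, t k = L k * embn 𝒜 (T k) * Linv k)
    (hr : ∀ k, r k = L k * embn 𝒜 (R k) * Linv (-k))
    :
    ∀ k₁ k₂ (i j l : Fin n),
      a k₁ i * t k₂ j l =
      ∑ q, ∑ r', ∑ s, ∑ m,
        (S21 S k₂ k₁ (i, j) (r', q) * S k₁ k₂ (r', s) (m, l)) • (t k₂ q s * a k₁ m) := by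
  intro k₁ k₂ i j l
  rw [ht]
  exact vector_mul_dressed_entry (hL k₂).1 (hL k₂).2 (mul_eq_one_comm.mp (hU k₁ k₂))
    (fun i l j => hWB1 k₂ k₁ i l j) (T k₂) i j l
end

section
/- (Proposition 2, relation rt-5: exchange of annihilation generators with the dressed reflection matrix.) With r(k) = L(k)R(k)L(−k)⁻¹, for all k₁,k₂ ∈ ℝ and all indices i,j,l ∈ {1,…,n}: a_i(k₁) r_{jl}(k₂) = Σ_{q,r,s,m} [S₂₁(k₂,k₁)]^{(i,j)}_{(r,q)} r_{qs}(k₂) [S₁₂(k₁,−k₂)]^{(r,s)}_{(m,l)} a_m(k₁). -/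
open scoped Matrix BigOperators

variable {n : ℕ}

theorem eq_sum_smul_of_mul_eq_one {ι M : Type*} [Fintype ι] [DecidableEq ι] [AddCommMonoid M]
    [Module ℂ M] {A B : Matrix ι ι ℂ} (hBA : B * A = 1) {u w : ι → M}
    (hu : ∀ x, u x = ∑ y, A x y • w y) (x : ι) : w x = ∑ y, B x y • u y := by
  simp only [hu, Finset.smul_sum, smul_smul]
  rw [Finset.sum_comm]
  simp only [← Finset.sum_smul, ← Matrix.mul_apply, hBA, Matrix.one_apply, ite_smul, one_smul,
    zero_smul, Finset.sum_ite_eq, Finset.mem_univ, if_true]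

/-- An exchange relation for `M` extends to `M * N` when the entries of `N` are scalars. -/
theorem exchange_mul_embn {𝒜 : Type*} [Ring 𝒜] [Algebra ℂ 𝒜] {b : Fin n → 𝒜}
    {M : Matrix (Fin n) (Fin n) 𝒜} {W : Matrix (Fin n × Fin n) (Fin n × Fin n) ℂ}
    (h : ∀ i j l, b i * M j l = ∑ p, ∑ q, W (i, j) (p, q) • (M q l * b p))
    (N : Matrix (Fin n) (Fin n) ℂ) (i j l : Fin n) :
    b i * (M * embn 𝒜 N) j l =
      ∑ p, ∑ q, W (i, j) (p, q) • ((M * embn 𝒜 N) q l * b p) := by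
  have hentry (q : Fin n) : (M * embn 𝒜 N) q l = ∑ x, N x l • M q x := by
    simp only [Matrix.mul_apply, embn, Matrix.map_apply, Algebra.smul_def, Algebra.commutes]
  simp only [hentry, Finset.mul_sum, Finset.sum_mul, Finset.smul_sum, mul_smul_comm,
    smul_mul_assoc, h]
  rw [Finset.sum_comm]
  refine Finset.sum_congr rfl fun p _ => ?_
  rw [Finset.sum_comm]
  exact Finset.sum_congr rfl fun q _ => Finset.sum_congr rfl fun x _ => smul_comm _ _ _

/-- An exchange relation moving `b` to the left through `M` yields one moving `b` to the right
through the inverse of `M`. -/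
theorem exchange_inv {𝒜 : Type*} [Ring 𝒜] [Algebra ℂ 𝒜] {b : Fin n → 𝒜}
    {M N : Matrix (Fin n) (Fin n) 𝒜} (hMN : M * N = 1) (hNM : N * M = 1)
    {W : Matrix (Fin n × Fin n) (Fin n × Fin n) ℂ}
    (h : ∀ i j l, M j l * b i = ∑ p, ∑ q, W (i, j) (p, q) • (b p * M q l)) (i j l : Fin n) :
    b i * N j l = ∑ s, ∑ m, W (i, s) (m, l) • (N j s * b m) := by
  have hcol (s : Fin n) : ∑ y, M s y * b i * N y l = ∑ m, W (i, s) (m, l) • b m := by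
    simp only [h, Finset.sum_mul, smul_mul_assoc, mul_assoc]
    rw [Finset.sum_comm]
    refine Finset.sum_congr rfl fun p _ => ?_
    rw [Finset.sum_comm]
    simp only [← Finset.smul_sum, ← Finset.mul_sum, ← Matrix.mul_apply, hMN, Matrix.one_apply,
      mul_ite, mul_one, mul_zero, smul_ite, smul_zero, Finset.sum_ite_eq', Finset.mem_univ,
      if_true]
  calc b i * N j l = ∑ y, (N * M) j y * (b i * N y l) := by
        simp [hNM, Matrix.one_apply]
    _ = ∑ s, N j s * ∑ y, M s y * b i * N y l := by
        simp only [Matrix.mul_apply, Finset.sum_mul, Finset.mul_sum, mul_assoc]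
        exact Finset.sum_comm
    _ = ∑ s, ∑ m, W (i, s) (m, l) • (N j s * b m) := by
        simp only [hcol, Finset.mul_sum, mul_smul_comm]

/-- Exchange relations for `M` and `N` compose to one for `M * N`. -/
theorem exchange_mul {𝒜 : Type*} [Ring 𝒜] [Algebra ℂ 𝒜] {b : Fin n → 𝒜}
    {M N : Matrix (Fin n) (Fin n) 𝒜} {V W : Matrix (Fin n × Fin n) (Fin n × Fin n) ℂ}
    (hM : ∀ i j l, b i * M j l = ∑ p, ∑ q, V (i, j) (p, q) • (M q l * b p))
    (hN : ∀ i j l, b i * N j l = ∑ s, ∑ m, W (i, s) (m, l) • (N j s * b m)) (i j l : Fin n) :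
    b i * (M * N) j l = ∑ q, ∑ p, ∑ s, ∑ m,
      (V (i, j) (p, q) * W (p, s) (m, l)) • ((M * N) q s * b m) := by
  have hrow (p q : Fin n) : ∑ x, M q x * (b p * N x l) =
      ∑ s, ∑ m, W (p, s) (m, l) • ((M * N) q s * b m) := by
    simp only [hN, Finset.mul_sum, mul_smul_comm, Matrix.mul_apply, Finset.sum_mul,
      Finset.smul_sum, mul_assoc]
    rw [Finset.sum_comm]
    exact Finset.sum_congr rfl fun s _ => Finset.sum_comm
  calc b i * (M * N) j l
      = ∑ x, ∑ p, ∑ q, V (i, j) (p, q) • (M q x * (b p * N x l)) := by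
        simp only [Matrix.mul_apply, Finset.mul_sum, ← mul_assoc, hM, Finset.sum_mul,
          smul_mul_assoc]
    _ = ∑ p, ∑ q, V (i, j) (p, q) • ∑ x, M q x * (b p * N x l) := by
        simp only [Finset.smul_sum]
        rw [Finset.sum_comm]
        exact Finset.sum_congr rfl fun p _ => Finset.sum_comm
    _ = _ := by
        rw [Finset.sum_comm]
        simp only [hrow, Finset.smul_sum, smul_smul]

theorem stmt_1
    (hn : 1 ≤ n)
    (S : ℝ → ℝ → Matrix (Fin n × Fin n) (Fin n × Fin n) ℂ)
    (hU : ∀ k₁ k₂, S k₁ k₂ * S21 S k₂ k₁ = 1)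
    (hYB : ∀ k₁ k₂ k₃,
      leg12 (S k₁ k₂) * leg13 (S k₁ k₃) * leg23 (S k₂ k₃) =
        leg23 (S k₂ k₃) * leg13 (S k₁ k₃) * leg12 (S k₁ k₂))
    (T R : ℝ → Matrix (Fin n) (Fin n) ℂ)
    (hT : ∀ k, (T k)ᴴ = T k)
    (hR : ∀ k, (R k)ᴴ = R (-k))
    (hTRu : ∀ k, T k * T k + R k * R (-k) = 1)
    (hTRz : ∀ k, T k * R k + R k * T (-k) = 0)
    (hbYB : ∀ k₁ k₂,
      S k₁ k₂ * leg1 (R k₁) * S21 S k₂ (-k₁) * leg2 (R k₂) =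
        leg2 (R k₂) * S k₁ (-k₂) * leg1 (R k₁) * S21 S (-k₂) (-k₁))
    (htYB : ∀ k₁ k₂,
      S k₁ k₂ * leg1 (T k₁) * S21 S k₂ k₁ * leg2 (T k₂) =
        leg2 (T k₂) * S k₁ k₂ * leg1 (T k₁) * S21 S k₂ k₁)
    (hrtYB : ∀ k₁ k₂,
      S k₁ k₂ * leg1 (T k₁) * S21 S k₂ k₁ * leg2 (R k₂) =
        leg2 (R k₂) * S k₁ (-k₂) * leg1 (T k₁) * S21 S (-k₂) k₁)
    (𝒜 : Type*) [Ring 𝒜] [Algebra ℂ 𝒜]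
    (a ad : ℝ → Fin n → 𝒜)
    (L Linv : ℝ → Matrix (Fin n) (Fin n) 𝒜)
    (hL : ∀ k, L k * Linv k = 1 ∧ Linv k * L k = 1)
    (hZF1 : ∀ k₁ k₂ (i j : Fin n), a k₁ i * a k₂ j =
      ∑ p, ∑ q, S21 S k₂ k₁ (i, j) (p, q) • (a k₂ q * a k₁ p))
    (hZF2 : ∀ k₁ k₂ (i j : Fin n), ad k₁ i * ad k₂ j =
      ∑ p, ∑ q, S21 S k₂ k₁ (p, q) (i, j) • (ad k₂ q * ad k₁ p))
    (hWB1 : ∀ k₁ k₂ (i l j : Fin n), L k₁ i l * a k₂ j =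
      ∑ p, ∑ q, S21 S k₂ k₁ (i, j) (p, q) • (a k₂ q * L k₁ p l))
    (hWB2 : ∀ k₁ k₂ (i l j : Fin n), L k₁ i l * ad k₂ j =
      ∑ p, ∑ q, S k₁ k₂ (i, p) (q, j) • (ad k₂ p * L k₁ q l))
    (hRLL : ∀ k₁ k₂,
      emb 𝒜 (S k₁ k₂) * leg1 (L k₁) * leg2 (L k₂) =
        leg2 (L k₂) * leg1 (L k₁) * emb 𝒜 (S k₁ k₂))
    (t r : ℝ → Matrix (Fin n) (Fin n) 𝒜)
    (ht : ∀ k, t k = L k * embn 𝒜 (T k) * Linv k)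
    (hr : ∀ k, r k = L k * embn 𝒜 (R k) * Linv (-k))
    :
    ∀ k₁ k₂ (i j l : Fin n),
      a k₁ i * r k₂ j l =
      ∑ q, ∑ r', ∑ s, ∑ m,
        (S21 S k₂ k₁ (i, j) (r', q) * S k₁ (-k₂) (r', s) (m, l)) • (r k₂ q s * a k₁ m) := by
  intro k₁ k₂ i j l
  have hLa (k : ℝ) (i j l : Fin n) : L k j l * a k₁ i =
      ∑ p, ∑ q, S k₁ k (i, j) (p, q) • (a k₁ p * L k q l) := by
    rw [hWB1, Finset.sum_comm]
    rfl
  have haL (i j l : Fin n) : a k₁ i * L k₂ j l =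
      ∑ p, ∑ q, S21 S k₂ k₁ (i, j) (p, q) • (L k₂ q l * a k₁ p) := by
    rw [← Fintype.sum_prod_type']
    refine eq_sum_smul_of_mul_eq_one (mul_eq_one_comm.mp (hU k₁ k₂))
      (u := fun x => L k₂ x.2 l * a k₁ x.1) (w := fun x => a k₁ x.1 * L k₂ x.2 l)
      (fun x => ?_) (i, j)
    rw [Fintype.sum_prod_type]
    exact hLa k₂ x.1 x.2 l
  rw [hr]
  exact exchange_mul (exchange_mul_embn haL (R k₂))
    (exchange_inv (hL (-k₂)).1 (hL (-k₂)).2 (hLa (-k₂))) i j l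
end

section
/- (Proposition 2, relation rt-7: exchange of the dressed reflection matrix with creation generators.) With r(k) = L(k)R(k)L(−k)⁻¹, for all k₁,k₂ ∈ ℝ and all indices i,l,j ∈ {1,…,n}: r_{il}(k₁) a†_j(k₂) = Σ_{p,q,r,s} a†_p(k₂) [S₁₂(k₁,k₂)]^{(i,p)}_{(q,r)} r_{qs}(k₁) [S₂₁(k₂,−k₁)]^{(s,r)}_{(l,j)}. -/
open scoped Matrix BigOperators

variable {n : ℕ}

/-- If `x d_j = ∑ₚ dₚ m_{pj} x` and `m` has right inverse `w`,
then `x⁻¹ d_j = ∑ₚ dₚ x⁻¹ w_{pj}`. -/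
theorem inv_exchange {B ι : Type*} [Ring B] [Fintype ι] [DecidableEq ι]
    {d : ι → B} {m w : ι → ι → B} {x y : B} (hxy : x * y = 1) (hyx : y * x = 1)
    (hmw : ∀ p j, ∑ c, m p c * w c j = if p = j then 1 else 0)
    (hx : ∀ j, x * d j = ∑ p, d p * m p j * x) (j : ι) :
    y * d j = ∑ p, d p * y * w p j := by
  have key : x * ∑ p, d p * y * w p j = d j := by
    calc x * ∑ c, d c * y * w c j
        = ∑ c, ∑ p, d p * (m p c * w c j) := by
          rw [Finset.mul_sum]
          refine Finset.sum_congr rfl fun c _ => ?_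
          rw [← mul_assoc, ← mul_assoc, hx, Finset.sum_mul, Finset.sum_mul]
          refine Finset.sum_congr rfl fun p _ => ?_
          rw [mul_assoc _ x y, hxy, mul_one, mul_assoc]
      _ = d j := by
          rw [Finset.sum_comm]
          simp [← Finset.mul_sum, hmw]
  calc y * d j = y * (x * ∑ p, d p * y * w p j) := by rw [key]
    _ = ∑ p, d p * y * w p j := by rw [← mul_assoc, hyx, one_mul]

/-- Exchange relation of the dressed element `x ρ y`, where `ρ` commutes with every `d_j`. -/
theorem dressed_exchange {B ι : Type*} [Ring B] [Fintype ι]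
    {d : ι → B} {m w : ι → ι → B} {x y ρ : B} (hρ : ∀ j, ρ * d j = d j * ρ)
    (hx : ∀ j, x * d j = ∑ p, d p * m p j * x)
    (hy : ∀ j, y * d j = ∑ p, d p * y * w p j) (j : ι) :
    x * ρ * y * d j = ∑ c, ∑ p, d p * (m p c * (x * ρ * y) * w c j) := by
  rw [mul_assoc, hy, Finset.mul_sum]
  refine Finset.sum_congr rfl fun c _ => ?_
  calc x * ρ * (d c * y * w c j) = x * (ρ * d c) * y * w c j := by simp only [mul_assoc]
    _ = (x * d c) * (ρ * y * w c j) := by rw [hρ]; simp only [mul_assoc]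
    _ = _ := by
      rw [hx, Finset.sum_mul]
      exact Finset.sum_congr rfl fun p _ => by simp only [mul_assoc]

/-- The `n × n` block of an `n² × n²` matrix at fixed second-factor indices. -/
def block (W : Matrix (Fin n × Fin n) (Fin n × Fin n) ℂ) (p c : Fin n) :
    Matrix (Fin n) (Fin n) ℂ :=
  Matrix.of fun i q => W (i, p) (q, c)

theorem sum_block_mul_block (V W : Matrix (Fin n × Fin n) (Fin n × Fin n) ℂ) (p j : Fin n) :
    ∑ c, block V p c * block W c j = block (V * W) p j := by
  ext i l
  simp only [block, Matrix.sum_apply, Matrix.mul_apply, Matrix.of_apply, Fintype.sum_prod_type]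
  exact Finset.sum_comm

theorem block_one (p j : Fin n) :
    block (1 : Matrix (Fin n × Fin n) (Fin n × Fin n) ℂ) p j = if p = j then 1 else 0 := by
  ext i l
  by_cases h : p = j <;> simp [block, Matrix.one_apply, h]

section

variable {𝒜 : Type*} [Ring 𝒜] [Algebra ℂ 𝒜]

theorem embn_mul (M N : Matrix (Fin n) (Fin n) ℂ) :
    embn 𝒜 (M * N) = embn 𝒜 M * embn 𝒜 N :=
  Matrix.map_mul

theorem embn_sum {ι : Type*} (s : Finset ι) (M : ι → Matrix (Fin n) (Fin n) ℂ) :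
    embn 𝒜 (∑ c ∈ s, M c) = ∑ c ∈ s, embn 𝒜 (M c) :=
  map_sum (algebraMap ℂ 𝒜).mapMatrix M s

theorem embn_mul_diagonal (M : Matrix (Fin n) (Fin n) ℂ) (x : 𝒜) :
    embn 𝒜 M * Matrix.diagonal (fun _ => x) = Matrix.diagonal (fun _ => x) * embn 𝒜 M := by
  ext i l
  simp [embn, Algebra.commutes]

/-- The entrywise relation `x_{il} d_j = ∑ V^{(i,p)}_{(q,j)} dₚ x_{ql}` as an identity of
`n × n` matrices. -/
theorem mul_diagonal_of_exchange {X : Matrix (Fin n) (Fin n) 𝒜} {d : Fin n → 𝒜}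
    {V : Matrix (Fin n × Fin n) (Fin n × Fin n) ℂ}
    (h : ∀ i l j, X i l * d j = ∑ p, ∑ q, V (i, p) (q, j) • (d p * X q l)) (j : Fin n) :
    X * Matrix.diagonal (fun _ => d j) =
      ∑ p, Matrix.diagonal (fun _ => d p) * embn 𝒜 (block V p j) * X := by
  ext i l
  rw [Matrix.mul_diagonal, h, Matrix.sum_apply]
  refine Finset.sum_congr rfl fun p _ => ?_
  rw [mul_assoc, Matrix.diagonal_mul, Matrix.mul_apply, Finset.mul_sum]
  refine Finset.sum_congr rfl fun q _ => ?_
  simp [embn, block, ← Algebra.smul_def]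

theorem embn_mul_mul_embn_apply (M N : Matrix (Fin n) (Fin n) ℂ) (X : Matrix (Fin n) (Fin n) 𝒜)
    (i l : Fin n) :
    (embn 𝒜 M * X * embn 𝒜 N) i l = ∑ q, ∑ s, (M i q * N s l) • X q s := by
  simp only [Matrix.mul_apply, Finset.sum_mul]
  rw [Finset.sum_comm]
  refine Finset.sum_congr rfl fun q _ => Finset.sum_congr rfl fun s _ => ?_
  simp only [embn, Matrix.map_apply]
  rw [← Algebra.commutes, ← Algebra.smul_def, ← Algebra.smul_def, smul_smul, mul_comm]

end

theorem stmt_3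
    (hn : 1 ≤ n)
    (S : ℝ → ℝ → Matrix (Fin n × Fin n) (Fin n × Fin n) ℂ)
    (hU : ∀ k₁ k₂, S k₁ k₂ * S21 S k₂ k₁ = 1)
    (hYB : ∀ k₁ k₂ k₃,
      leg12 (S k₁ k₂) * leg13 (S k₁ k₃) * leg23 (S k₂ k₃) =
        leg23 (S k₂ k₃) * leg13 (S k₁ k₃) * leg12 (S k₁ k₂))
    (T R : ℝ → Matrix (Fin n) (Fin n) ℂ)
    (hT : ∀ k, (T k)ᴴ = T k)
    (hR : ∀ k, (R k)ᴴ = R (-k))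
    (hTRu : ∀ k, T k * T k + R k * R (-k) = 1)
    (hTRz : ∀ k, T k * R k + R k * T (-k) = 0)
    (hbYB : ∀ k₁ k₂,
      S k₁ k₂ * leg1 (R k₁) * S21 S k₂ (-k₁) * leg2 (R k₂) =
        leg2 (R k₂) * S k₁ (-k₂) * leg1 (R k₁) * S21 S (-k₂) (-k₁))
    (htYB : ∀ k₁ k₂,
      S k₁ k₂ * leg1 (T k₁) * S21 S k₂ k₁ * leg2 (T k₂) =
        leg2 (T k₂) * S k₁ k₂ * leg1 (T k₁) * S21 S k₂ k₁)
    (hrtYB : ∀ k₁ k₂,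
      S k₁ k₂ * leg1 (T k₁) * S21 S k₂ k₁ * leg2 (R k₂) =
        leg2 (R k₂) * S k₁ (-k₂) * leg1 (T k₁) * S21 S (-k₂) k₁)
    (𝒜 : Type*) [Ring 𝒜] [Algebra ℂ 𝒜]
    (a ad : ℝ → Fin n → 𝒜)
    (L Linv : ℝ → Matrix (Fin n) (Fin n) 𝒜)
    (hL : ∀ k, L k * Linv k = 1 ∧ Linv k * L k = 1)
    (hZF1 : ∀ k₁ k₂ (i j : Fin n), a k₁ i * a k₂ j =
      ∑ p, ∑ q, S21 S k₂ k₁ (i, j) (p, q) • (a k₂ q * a k₁ p))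
    (hZF2 : ∀ k₁ k₂ (i j : Fin n), ad k₁ i * ad k₂ j =
      ∑ p, ∑ q, S21 S k₂ k₁ (p, q) (i, j) • (ad k₂ q * ad k₁ p))
    (hWB1 : ∀ k₁ k₂ (i l j : Fin n), L k₁ i l * a k₂ j =
      ∑ p, ∑ q, S21 S k₂ k₁ (i, j) (p, q) • (a k₂ q * L k₁ p l))
    (hWB2 : ∀ k₁ k₂ (i l j : Fin n), L k₁ i l * ad k₂ j =
      ∑ p, ∑ q, S k₁ k₂ (i, p) (q, j) • (ad k₂ p * L k₁ q l))
    (hRLL : ∀ k₁ k₂,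
      emb 𝒜 (S k₁ k₂) * leg1 (L k₁) * leg2 (L k₂) =
        leg2 (L k₂) * leg1 (L k₁) * emb 𝒜 (S k₁ k₂))
    (t r : ℝ → Matrix (Fin n) (Fin n) 𝒜)
    (ht : ∀ k, t k = L k * embn 𝒜 (T k) * Linv k)
    (hr : ∀ k, r k = L k * embn 𝒜 (R k) * Linv (-k))
    :
    ∀ k₁ k₂ (i l j : Fin n),
      r k₁ i l * ad k₂ j =
      ∑ p, ∑ q, ∑ r', ∑ s,
        (S k₁ k₂ (i, p) (q, r') * S21 S k₂ (-k₁) (s, r') (l, j)) • (ad k₂ p * r k₁ q s) := by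
  intro k₁ k₂ i l j
  have hx (k : ℝ) := mul_diagonal_of_exchange (hWB2 k k₂)
  have hmw (p j : Fin n) : ∑ c, embn 𝒜 (block (S (-k₁) k₂) p c) *
      embn 𝒜 (block (S21 S k₂ (-k₁)) c j) = if p = j then 1 else 0 := by
    simp_rw [← embn_mul]
    rw [← embn_sum, sum_block_mul_block, hU, block_one]
    split_ifs <;> simp [embn]
  have hy := inv_exchange (hL (-k₁)).1 (hL (-k₁)).2 hmw (hx (-k₁))
  have h := congr_fun₂ (dressed_exchange (fun c => embn_mul_diagonal (R k₁) (ad k₂ c))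
    (hx k₁) hy j) i l
  rw [← hr] at h
  simp only [Matrix.mul_diagonal, Matrix.sum_apply, Matrix.diagonal_mul,
    embn_mul_mul_embn_apply, Finset.mul_sum, mul_smul_comm, block, Matrix.of_apply] at h
  rw [h, Finset.sum_comm]
  exact Finset.sum_congr rfl fun p _ => Finset.sum_comm
end

section
/- (Proposition 2, relation rt-8: transmission–transmission exchange for the dressed matrices.) With t(k) = L(k)T(k)L(k)⁻¹, for all k₁,k₂ ∈ ℝ the following identity holds in M_{n²}(𝒜): S₁₂(k₁,k₂) t₁(k₁) S₂₁(k₂,k₁) t₂(k₂) = t₂(k₂) S₁₂(k₁,k₂) t₁(k₁) S₂₁(k₂,k₁), where t₁ = t⊗Iₙ, t₂ = Iₙ⊗t and the scalar matrices S₁₂, S₂₁ act entrywise on 𝒜. -/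
open scoped Matrix BigOperators

variable {n : ℕ}

section Legs

variable {A : Type*} [Semiring A]

lemma leg1_mul (M N : Matrix (Fin n) (Fin n) A) : leg1 (M * N) = leg1 M * leg1 N := by
  ext ⟨i, j⟩ ⟨p, q⟩
  simp only [leg1, Matrix.mul_apply, Matrix.of_apply, Fintype.sum_prod_type, ite_mul, mul_ite,
    zero_mul, mul_zero]
  by_cases h : j = q <;> simp [h]

lemma leg2_mul (M N : Matrix (Fin n) (Fin n) A) : leg2 (M * N) = leg2 M * leg2 N := by
  ext ⟨i, j⟩ ⟨p, q⟩
  simp only [leg2, Matrix.mul_apply, Matrix.of_apply, Fintype.sum_prod_type_right, ite_mul,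
    mul_ite, zero_mul, mul_zero]
  by_cases h : i = p <;> simp [h]

lemma leg1_one : leg1 (1 : Matrix (Fin n) (Fin n) A) = 1 := by
  ext ⟨i, j⟩ ⟨p, q⟩
  by_cases h : j = q <;> simp [leg1, Matrix.one_apply, h]

lemma leg2_one : leg2 (1 : Matrix (Fin n) (Fin n) A) = 1 := by
  ext ⟨i, j⟩ ⟨p, q⟩
  by_cases h : i = p <;> simp [leg2, Matrix.one_apply, h]

lemma commute_leg1_leg2 {M N : Matrix (Fin n) (Fin n) A}
    (h : ∀ i j p q, Commute (M i j) (N p q)) : Commute (leg1 M) (leg2 N) := by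
  ext ⟨i, j⟩ ⟨p, q⟩
  simpa [leg1, leg2, Matrix.mul_apply, Fintype.sum_prod_type] using (h i p j q).eq

end Legs

section Embedding

variable (𝒜 : Type*) [Ring 𝒜] [Algebra ℂ 𝒜]

lemma emb_mul (M N : Matrix (Fin n × Fin n) (Fin n × Fin n) ℂ) :
    emb 𝒜 (M * N) = emb 𝒜 M * emb 𝒜 N :=
  Matrix.map_mul

lemma emb_one : emb 𝒜 (1 : Matrix (Fin n × Fin n) (Fin n × Fin n) ℂ) = 1 :=
  Matrix.map_one _ (map_zero _) (map_one _)

lemma emb_leg1 (M : Matrix (Fin n) (Fin n) ℂ) : emb 𝒜 (leg1 M) = leg1 (embn 𝒜 M) := by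
  ext ⟨i, j⟩ ⟨p, q⟩
  by_cases h : j = q <;> simp [emb, embn, leg1, h]

lemma emb_leg2 (M : Matrix (Fin n) (Fin n) ℂ) : emb 𝒜 (leg2 M) = leg2 (embn 𝒜 M) := by
  ext ⟨i, j⟩ ⟨p, q⟩
  by_cases h : i = p <;> simp [emb, embn, leg2, h]

variable {𝒜}

lemma commute_leg1_embn_leg2 (M : Matrix (Fin n) (Fin n) ℂ) (N : Matrix (Fin n) (Fin n) 𝒜) :
    Commute (leg1 (embn 𝒜 M)) (leg2 N) :=
  commute_leg1_leg2 fun _ _ _ _ => Algebra.commutes _ _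

lemma commute_leg1_leg2_embn (M : Matrix (Fin n) (Fin n) 𝒜) (N : Matrix (Fin n) (Fin n) ℂ) :
    Commute (leg1 M) (leg2 (embn 𝒜 N)) :=
  commute_leg1_leg2 fun _ _ _ _ => (Algebra.commutes _ _).symm

end Embedding

/-- Conjugating a solution `x`, `y` of the transmission Yang–Baxter equation by invertible `a`, `b`
obeying the RLL relation gives another solution. -/
lemma dressed_exchange_s4 {M : Type*} [Monoid M] {s a b : Mˣ} {x y : M}
    (hRLL : s * a * b = b * a * s) (hxb : Commute x b) (hay : Commute (a : M) y)
    (hxy : s * x * ↑s⁻¹ * y = y * s * x * ↑s⁻¹) :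
    s * (a * x * ↑a⁻¹) * ↑s⁻¹ * (b * y * ↑b⁻¹) =
      b * y * ↑b⁻¹ * s * (a * x * ↑a⁻¹) * ↑s⁻¹ := by
  have h₁ : a⁻¹ * s⁻¹ * b = b * s⁻¹ * a⁻¹ := by
    rw [eq_mul_inv_iff_mul_eq, eq_mul_inv_iff_mul_eq]
    simp only [mul_assoc, inv_mul_eq_iff_eq_mul] at hRLL ⊢
    exact hRLL.symm
  have h₂ : b⁻¹ * s * a = a * s * b⁻¹ := by
    rw [eq_mul_inv_iff_mul_eq]
    simp only [mul_assoc, inv_mul_eq_iff_eq_mul] at hRLL ⊢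
    exact hRLL
  have h₃ : b⁻¹ * a⁻¹ * s⁻¹ = s⁻¹ * a⁻¹ * b⁻¹ := by
    simpa only [mul_inv_rev, mul_assoc] using congrArg (·⁻¹) hRLL
  replace h₁ := congrArg Units.val h₁
  replace h₂ := congrArg Units.val h₂
  replace h₃ := congrArg Units.val h₃
  replace hRLL := congrArg Units.val hRLL
  simp only [Units.val_mul] at h₁ h₂ h₃ hRLL
  calc (s : M) * (a * x * ↑a⁻¹) * ↑s⁻¹ * (b * y * ↑b⁻¹)
      = s * a * x * (↑a⁻¹ * ↑s⁻¹ * b) * y * ↑b⁻¹ := by simp only [mul_assoc]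
    _ = s * a * (x * b) * ↑s⁻¹ * (↑a⁻¹ * y) * ↑b⁻¹ := by rw [h₁]; simp only [mul_assoc]
    _ = (s * a * b) * x * ↑s⁻¹ * y * ↑a⁻¹ * ↑b⁻¹ := by
      rw [hxb.eq, hay.units_inv_left.eq]; simp only [mul_assoc]
    _ = b * a * (s * x * ↑s⁻¹ * y) * ↑a⁻¹ * ↑b⁻¹ := by rw [hRLL]; simp only [mul_assoc]
    _ = b * (a * y) * s * x * (↑s⁻¹ * ↑a⁻¹ * ↑b⁻¹) := by rw [hxy]; simp only [mul_assoc]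
    _ = b * y * (a * s) * (x * ↑b⁻¹) * ↑a⁻¹ * ↑s⁻¹ := by
      rw [hay.eq, ← h₃]; simp only [mul_assoc]
    _ = b * y * (a * s * ↑b⁻¹) * x * ↑a⁻¹ * ↑s⁻¹ := by
      rw [hxb.units_inv_right.eq]; simp only [mul_assoc]
    _ = b * y * ↑b⁻¹ * s * (a * x * ↑a⁻¹) * ↑s⁻¹ := by rw [← h₂]; simp only [mul_assoc]

theorem stmt_4
    (hn : 1 ≤ n)
    (S : ℝ → ℝ → Matrix (Fin n × Fin n) (Fin n × Fin n) ℂ)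
    (hU : ∀ k₁ k₂, S k₁ k₂ * S21 S k₂ k₁ = 1)
    (hYB : ∀ k₁ k₂ k₃,
      leg12 (S k₁ k₂) * leg13 (S k₁ k₃) * leg23 (S k₂ k₃) =
        leg23 (S k₂ k₃) * leg13 (S k₁ k₃) * leg12 (S k₁ k₂))
    (T R : ℝ → Matrix (Fin n) (Fin n) ℂ)
    (hT : ∀ k, (T k)ᴴ = T k)
    (hR : ∀ k, (R k)ᴴ = R (-k))
    (hTRu : ∀ k, T k * T k + R k * R (-k) = 1)
    (hTRz : ∀ k, T k * R k + R k * T (-k) = 0)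
    (hbYB : ∀ k₁ k₂,
      S k₁ k₂ * leg1 (R k₁) * S21 S k₂ (-k₁) * leg2 (R k₂) =
        leg2 (R k₂) * S k₁ (-k₂) * leg1 (R k₁) * S21 S (-k₂) (-k₁))
    (htYB : ∀ k₁ k₂,
      S k₁ k₂ * leg1 (T k₁) * S21 S k₂ k₁ * leg2 (T k₂) =
        leg2 (T k₂) * S k₁ k₂ * leg1 (T k₁) * S21 S k₂ k₁)
    (hrtYB : ∀ k₁ k₂,
      S k₁ k₂ * leg1 (T k₁) * S21 S k₂ k₁ * leg2 (R k₂) =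
        leg2 (R k₂) * S k₁ (-k₂) * leg1 (T k₁) * S21 S (-k₂) k₁)
    (𝒜 : Type*) [Ring 𝒜] [Algebra ℂ 𝒜]
    (a ad : ℝ → Fin n → 𝒜)
    (L Linv : ℝ → Matrix (Fin n) (Fin n) 𝒜)
    (hL : ∀ k, L k * Linv k = 1 ∧ Linv k * L k = 1)
    (hZF1 : ∀ k₁ k₂ (i j : Fin n), a k₁ i * a k₂ j =
      ∑ p, ∑ q, S21 S k₂ k₁ (i, j) (p, q) • (a k₂ q * a k₁ p))
    (hZF2 : ∀ k₁ k₂ (i j : Fin n), ad k₁ i * ad k₂ j =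
      ∑ p, ∑ q, S21 S k₂ k₁ (p, q) (i, j) • (ad k₂ q * ad k₁ p))
    (hWB1 : ∀ k₁ k₂ (i l j : Fin n), L k₁ i l * a k₂ j =
      ∑ p, ∑ q, S21 S k₂ k₁ (i, j) (p, q) • (a k₂ q * L k₁ p l))
    (hWB2 : ∀ k₁ k₂ (i l j : Fin n), L k₁ i l * ad k₂ j =
      ∑ p, ∑ q, S k₁ k₂ (i, p) (q, j) • (ad k₂ p * L k₁ q l))
    (hRLL : ∀ k₁ k₂,
      emb 𝒜 (S k₁ k₂) * leg1 (L k₁) * leg2 (L k₂) =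
        leg2 (L k₂) * leg1 (L k₁) * emb 𝒜 (S k₁ k₂))
    (t r : ℝ → Matrix (Fin n) (Fin n) 𝒜)
    (ht : ∀ k, t k = L k * embn 𝒜 (T k) * Linv k)
    (hr : ∀ k, r k = L k * embn 𝒜 (R k) * Linv (-k))
    :
    ∀ k₁ k₂,
      emb 𝒜 (S k₁ k₂) * leg1 (t k₁) * emb 𝒜 (S21 S k₂ k₁) * leg2 (t k₂) =
        leg2 (t k₂) * emb 𝒜 (S k₁ k₂) * leg1 (t k₁) * emb 𝒜 (S21 S k₂ k₁) := by
  intro k₁ k₂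
  let s : (Matrix (Fin n × Fin n) (Fin n × Fin n) 𝒜)ˣ :=
    ⟨emb 𝒜 (S k₁ k₂), emb 𝒜 (S21 S k₂ k₁), by rw [← emb_mul, hU, emb_one],
      by rw [← emb_mul, mul_eq_one_comm.mp (hU k₁ k₂), emb_one]⟩
  let l₁ : (Matrix (Fin n × Fin n) (Fin n × Fin n) 𝒜)ˣ :=
    ⟨leg1 (L k₁), leg1 (Linv k₁), by rw [← leg1_mul, (hL k₁).1, leg1_one],
      by rw [← leg1_mul, (hL k₁).2, leg1_one]⟩
  let l₂ : (Matrix (Fin n × Fin n) (Fin n × Fin n) 𝒜)ˣ :=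
    ⟨leg2 (L k₂), leg2 (Linv k₂), by rw [← leg2_mul, (hL k₂).1, leg2_one],
      by rw [← leg2_mul, (hL k₂).2, leg2_one]⟩
  have hS := congrArg (emb 𝒜) (htYB k₁ k₂)
  simp only [emb_mul, emb_leg1, emb_leg2] at hS
  simp only [ht, leg1_mul, leg2_mul]
  exact dressed_exchange_s4 (s := s) (a := l₁) (b := l₂) (Units.ext (hRLL k₁ k₂))
    (commute_leg1_embn_leg2 _ _) (commute_leg1_leg2_embn _ _) hS
end

section
/- (Inversion-type identities for the image of ρ.) For all k ∈ ℝ and every index i: a_i(k) = Σ_j (t_{ij}(k)α_j(k) + r_{ij}(k)α_j(−k)) and a†_i(k) = Σ_j (α†_j(k)t_{ji}(k) + α†_j(−k)r_{ji}(−k)). -/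
open scoped Matrix BigOperators

variable {n : ℕ}

/-- The map `v ↦ (k ↦ t(k) v(k) + r(k) v(-k))` squares to the identity. -/
theorem mulVec_reflection_involutive {𝒜 ι : Type*} [Ring 𝒜] [Fintype ι] [DecidableEq ι]
    (t r : ℝ → Matrix ι ι 𝒜)
    (htt : ∀ k, t k * t k + r k * r (-k) = 1) (htr : ∀ k, t k * r k + r k * t (-k) = 0)
    {v w : ℝ → ι → 𝒜} (hw : ∀ k, w k = t k *ᵥ v k + r k *ᵥ v (-k)) (k : ℝ) :
    v k = t k *ᵥ w k + r k *ᵥ w (-k) := by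
  calc v k = (t k * t k + r k * r (-k)) *ᵥ v k + (t k * r k + r k * t (-k)) *ᵥ v (-k) := by
        simp [htt, htr]
    _ = t k *ᵥ w k + r k *ᵥ w (-k) := by
        simp only [hw, neg_neg, Matrix.add_mulVec, Matrix.mulVec_add, Matrix.mulVec_mulVec]
        abel

/-- The map `v ↦ (k ↦ v(k) t(k) + v(-k) r(-k))` squares to the identity. -/
theorem vecMul_reflection_involutive {𝒜 ι : Type*} [Ring 𝒜] [Fintype ι] [DecidableEq ι]
    (t r : ℝ → Matrix ι ι 𝒜)
    (htt : ∀ k, t k * t k + r k * r (-k) = 1) (htr : ∀ k, t k * r k + r k * t (-k) = 0)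
    {v w : ℝ → ι → 𝒜} (hw : ∀ k, w k = v k ᵥ* t k + v (-k) ᵥ* r (-k)) (k : ℝ) :
    v k = w k ᵥ* t k + w (-k) ᵥ* r (-k) := by
  have htr' : t (-k) * r (-k) + r (-k) * t k = 0 := by simpa using htr (-k)
  calc v k = v k ᵥ* (t k * t k + r k * r (-k))
          + v (-k) ᵥ* (t (-k) * r (-k) + r (-k) * t k) := by
        simp [htt, htr']
    _ = w k ᵥ* t k + w (-k) ᵥ* r (-k) := by
        simp only [hw, neg_neg, Matrix.vecMul_add, Matrix.add_vecMul, Matrix.vecMul_vecMul]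
        abel

theorem stmt_11
    (hn : 1 ≤ n)
    (𝒜 : Type*) [Ring 𝒜] [Algebra ℂ 𝒜]
    (a ad : ℝ → Fin n → 𝒜)
    (t r : ℝ → Matrix (Fin n) (Fin n) 𝒜)
    (hE8 : ∀ k, t k * t k + r k * r (-k) = 1)
    (hE9 : ∀ k, t k * r k + r k * t (-k) = 0)
    (al ald A Ad : ℝ → Fin n → 𝒜)
    (hal : ∀ k (i : Fin n), al k i = ∑ j, (t k i j * a k j + r k i j * a (-k) j))
    (hald : ∀ k (i : Fin n), ald k i = ∑ j, (ad k j * t k j i + ad (-k) j * r (-k) j i))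
    (hA : ∀ k (i : Fin n), A k i = (2 : ℂ)⁻¹ • (a k i + al k i))
    (hAd : ∀ k (i : Fin n), Ad k i = (2 : ℂ)⁻¹ • (ad k i + ald k i))
    :
    ∀ k (i : Fin n),
      (a k i = ∑ j, (t k i j * al k j + r k i j * al (-k) j)) ∧
      (ad k i = ∑ j, (ald k j * t k j i + ald (-k) j * r (-k) j i)) := by
  intro k i
  have hal' : ∀ k, al k = t k *ᵥ a k + r k *ᵥ a (-k) := fun k => funext fun i => by
    simp only [hal, Finset.sum_add_distrib, Pi.add_apply, Matrix.mulVec, dotProduct]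
  have hald' : ∀ k, ald k = ad k ᵥ* t k + ad (-k) ᵥ* r (-k) := fun k => funext fun i => by
    simp only [hald, Finset.sum_add_distrib, Pi.add_apply, Matrix.vecMul, dotProduct]
  constructor
  · simpa only [Finset.sum_add_distrib, Pi.add_apply, Matrix.mulVec, dotProduct] using
      congrFun (mulVec_reflection_involutive t r hE8 hE9 hal' k) i
  · simpa only [Finset.sum_add_distrib, Pi.add_apply, Matrix.vecMul, dotProduct] using
      congrFun (vecMul_reflection_involutive t r hE8 hE9 hald' k) i
end

section
/- (Theorem 1, relation rt-2: the symmetrized generators satisfy the RT-algebra exchange relation among creation generators.) The elements A†_i(k) = (1/2)(a†_i(k)+α†_i(k)) satisfy, for all k₁,k₂ ∈ ℝ and indices i,j: A†_i(k₁)A†_j(k₂) = Σ_{p,q} A†_q(k₂)A†_p(k₁) [S₂₁(k₂,k₁)]^{(p,q)}_{(i,j)}. -/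
open scoped Matrix BigOperators

variable {n : ℕ}

/-- A vector seen as a matrix with a single row. -/
def rowVec {A : Type*} (v : Fin n → A) : Matrix Unit (Fin n) A :=
  Matrix.of fun _ i => v i

/-- `v₁ = v ⊗ Iₙ` for a row vector `v`. -/
def rowLeg1 {A : Type*} [Semiring A] (v : Fin n → A) : Matrix (Fin n) (Fin n × Fin n) A :=
  Matrix.of fun j y => if j = y.2 then v y.1 else 0

/-- `v₂ = Iₙ ⊗ v` for a row vector `v`. -/
def rowLeg2 {A : Type*} [Semiring A] (v : Fin n → A) : Matrix (Fin n) (Fin n × Fin n) A :=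
  Matrix.of fun i y => if i = y.1 then v y.2 else 0

section Semiring

variable {A : Type*} [Semiring A]

theorem rowVec_mul_rowLeg1 (u v : Fin n → A) :
    rowVec u * rowLeg1 v = Matrix.of fun _ y => u y.2 * v y.1 := by
  ext x y
  simp [rowVec, rowLeg1, Matrix.mul_apply]

theorem rowVec_mul_rowLeg2 (u v : Fin n → A) :
    rowVec u * rowLeg2 v = Matrix.of fun _ y => u y.1 * v y.2 := by
  ext x y
  simp [rowVec, rowLeg2, Matrix.mul_apply]

theorem rowLeg1_mul_apply {m : Type*} (v : Fin n → A) (M : Matrix (Fin n × Fin n) m A)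
    (j : Fin n) (y : m) : (rowLeg1 v * M) j y = ∑ p, v p * M (p, j) y := by
  simp [rowLeg1, Matrix.mul_apply, Fintype.sum_prod_type, ite_mul]

theorem rowLeg2_mul_apply {m : Type*} (v : Fin n → A) (M : Matrix (Fin n × Fin n) m A)
    (i : Fin n) (y : m) : (rowLeg2 v * M) i y = ∑ p, v p * M (i, p) y := by
  simp [rowLeg2, Matrix.mul_apply, Fintype.sum_prod_type, ite_mul]

theorem mul_rowLeg2_apply {m : Type*} (M : Matrix m (Fin n) A) (v : Fin n → A)
    (x : m) (y : Fin n × Fin n) : (M * rowLeg2 v) x y = M x y.1 * v y.2 := by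
  simp [rowLeg2, Matrix.mul_apply]

theorem leg1_mul_apply {m : Type*} (M : Matrix (Fin n) (Fin n) A)
    (N : Matrix (Fin n × Fin n) m A) (x : Fin n × Fin n) (y : m) :
    (leg1 M * N) x y = ∑ s, M x.1 s * N (s, x.2) y := by
  simp [leg1, Matrix.mul_apply, Fintype.sum_prod_type, ite_mul]

theorem rowLeg1_mul_leg1 (v w : Fin n → A) (M N : Matrix (Fin n) (Fin n) A) :
    rowLeg1 (fun i => ∑ j, (v j * M j i + w j * N j i)) =
      rowLeg1 v * leg1 M + rowLeg1 w * leg1 N := by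
  ext j y
  rw [Matrix.add_apply, rowLeg1_mul_apply, rowLeg1_mul_apply]
  by_cases h : j = y.2 <;> simp [rowLeg1, leg1, h, Finset.sum_add_distrib]

theorem rowLeg2_mul_leg2 (v w : Fin n → A) (M N : Matrix (Fin n) (Fin n) A) :
    rowLeg2 (fun i => ∑ j, (v j * M j i + w j * N j i)) =
      rowLeg2 v * leg2 M + rowLeg2 w * leg2 N := by
  ext j y
  rw [Matrix.add_apply, rowLeg2_mul_apply, rowLeg2_mul_apply]
  by_cases h : j = y.1 <;> simp [rowLeg2, leg2, h, Finset.sum_add_distrib]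

theorem rowVec_mul_add_mul (v w : Fin n → A) (M N : Matrix (Fin n) (Fin n) A) :
    rowVec (fun i => ∑ j, (v j * M j i + w j * N j i)) = rowVec v * M + rowVec w * N := by
  ext x y
  simp [rowVec, Matrix.mul_apply, Finset.sum_add_distrib]

theorem submatrix_mul_swap {l m : Type*} {l' m' : Type*} (M : Matrix l (Fin n × Fin n) A)
    (N : Matrix (Fin n × Fin n) m A) (f : l' → l) (g : m' → m) :
    (M * N).submatrix f g = M.submatrix f Prod.swap * N.submatrix Prod.swap g :=
  Matrix.submatrix_mul M N f Prod.swap g Prod.swap_bijective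

theorem submatrix_swap_leg1 (M : Matrix (Fin n) (Fin n) A) :
    (leg1 M).submatrix Prod.swap Prod.swap = leg2 M := rfl

theorem submatrix_swap_leg2 (M : Matrix (Fin n) (Fin n) A) :
    (leg2 M).submatrix Prod.swap Prod.swap = leg1 M := rfl

theorem submatrix_swap_rowLeg2 (v : Fin n → A) :
    (rowLeg2 v).submatrix id Prod.swap = rowLeg1 v := rfl

theorem submatrix_swap_mul_rowLeg1 {m : Type*} (M : Matrix m (Fin n) A) (v : Fin n → A) :
    (M * rowLeg1 v).submatrix id Prod.swap = M * rowLeg2 v := rfl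

theorem submatrix_swap_mul_rowLeg2 {m : Type*} (M : Matrix m (Fin n) A) (v : Fin n → A) :
    (M * rowLeg2 v).submatrix id Prod.swap = M * rowLeg1 v := rfl

end Semiring

section Algebra

variable {𝒜 : Type*} [Ring 𝒜] [Algebra ℂ 𝒜]
  {S : ℝ → ℝ → Matrix (Fin n × Fin n) (Fin n × Fin n) ℂ}

theorem submatrix_swap_emb (k₁ k₂ : ℝ) :
    (emb 𝒜 (S k₁ k₂)).submatrix Prod.swap Prod.swap = emb 𝒜 (S21 S k₁ k₂) := rfl

theorem submatrix_swap_emb_S21 (k₁ k₂ : ℝ) :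
    (emb 𝒜 (S21 S k₁ k₂)).submatrix Prod.swap Prod.swap = emb 𝒜 (S k₁ k₂) := rfl

theorem emb_mul_emb_S21 (hU : ∀ k₁ k₂, S k₁ k₂ * S21 S k₂ k₁ = 1) (k₁ k₂ : ℝ) :
    emb 𝒜 (S k₁ k₂) * emb 𝒜 (S21 S k₂ k₁) = 1 := by
  rw [emb, emb, ← Matrix.map_mul, hU]
  simp

theorem emb_S21_mul_emb (hU : ∀ k₁ k₂, S k₁ k₂ * S21 S k₂ k₁ = 1) (k₁ k₂ : ℝ) :
    emb 𝒜 (S21 S k₂ k₁) * emb 𝒜 (S k₁ k₂) = 1 := by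
  rw [emb, emb, ← Matrix.map_mul, mul_eq_one_comm.mp (hU k₁ k₂)]
  simp

/-- The quadratic exchange relation `u₁v₂ = v₂u₁W`, componentwise and in matrix form. -/
theorem exchange_iff (u v : Fin n → 𝒜) (W : Matrix (Fin n × Fin n) (Fin n × Fin n) ℂ) :
    rowVec u * rowLeg2 v = rowVec v * rowLeg1 u * emb 𝒜 W ↔
      ∀ i j, u i * v j = ∑ p, ∑ q, W (p, q) (i, j) • (v q * u p) := by
  have key : ∀ i j, (rowVec v * rowLeg1 u * emb 𝒜 W) () (i, j) =
      ∑ p, ∑ q, W (p, q) (i, j) • (v q * u p) := by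
    intro i j
    rw [rowVec_mul_rowLeg1, Matrix.mul_apply, Fintype.sum_prod_type]
    simp [emb, Algebra.smul_def, Algebra.commutes]
  rw [rowVec_mul_rowLeg2]
  constructor
  · intro h i j
    rw [← key, ← h, Matrix.of_apply]
  · intro h
    ext ⟨⟩ ⟨i, j⟩
    rw [key, Matrix.of_apply, h]

/-- The relation `M₁v₂ = v₂VM₁W`, from components to matrix form. -/
theorem mul_rowLeg2_of_apply (M : Matrix (Fin n) (Fin n) 𝒜) (v : Fin n → 𝒜)
    (V W : Matrix (Fin n × Fin n) (Fin n × Fin n) ℂ)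
    (h : ∀ i l j, M i l * v j = ∑ p, ∑ q, ∑ r, ∑ s,
      (V (i, p) (q, r) * W (s, r) (l, j)) • (v p * M q s)) :
    M * rowLeg2 v = rowLeg2 v * (emb 𝒜 V * (leg1 M * emb 𝒜 W)) := by
  ext i ⟨l, j⟩
  rw [mul_rowLeg2_apply, h, rowLeg2_mul_apply]
  refine Finset.sum_congr rfl fun p _ => ?_
  simp only [Matrix.mul_apply (M := emb 𝒜 V), Fintype.sum_prod_type, leg1_mul_apply,
    Finset.mul_sum]
  refine Finset.sum_congr rfl fun q _ => Finset.sum_congr rfl fun r _ =>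
    Finset.sum_congr rfl fun s _ => ?_
  simp only [emb, Matrix.map_apply]
  rw [← Algebra.commutes (W _ _), ← Algebra.smul_def, ← Algebra.smul_def, mul_smul_comm,
    mul_smul_comm, smul_smul]

/-- Exchange relations are symmetric, by unitarity. -/
theorem exchange_symm (hU : ∀ k₁ k₂, S k₁ k₂ * S21 S k₂ k₁ = 1) {k₁ k₂ : ℝ} {u v : Fin n → 𝒜}
    (h : rowVec u * rowLeg2 v = rowVec v * rowLeg1 u * emb 𝒜 (S21 S k₂ k₁)) :
    rowVec v * rowLeg2 u = rowVec u * rowLeg1 v * emb 𝒜 (S21 S k₁ k₂) := by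
  have h' : rowVec u * rowLeg1 v = rowVec v * rowLeg2 u * emb 𝒜 (S k₂ k₁) := by
    have := congrArg (fun M => M.submatrix id Prod.swap) h
    simpa only [submatrix_mul_swap, submatrix_swap_emb_S21, submatrix_swap_mul_rowLeg1,
      submatrix_swap_mul_rowLeg2] using this
  rw [h', Matrix.mul_assoc, emb_mul_emb_S21 hU, Matrix.mul_one]

theorem eq_S21_mul_of_mul_eq (hU : ∀ k₁ k₂, S k₁ k₂ * S21 S k₂ k₁ = 1) {k₁ k₂ : ℝ}
    {X Y : Matrix (Fin n × Fin n) (Fin n × Fin n) 𝒜} (h : emb 𝒜 (S k₁ k₂) * X = Y) :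
    X = emb 𝒜 (S21 S k₂ k₁) * Y := by
  rw [← h, ← Matrix.mul_assoc, emb_S21_mul_emb hU, Matrix.one_mul]

end Algebra

theorem stmt_13
    (hn : 1 ≤ n)
    (S : ℝ → ℝ → Matrix (Fin n × Fin n) (Fin n × Fin n) ℂ)
    (hU : ∀ k₁ k₂, S k₁ k₂ * S21 S k₂ k₁ = 1)
    (hYB : ∀ k₁ k₂ k₃,
      leg12 (S k₁ k₂) * leg13 (S k₁ k₃) * leg23 (S k₂ k₃) =
        leg23 (S k₂ k₃) * leg13 (S k₁ k₃) * leg12 (S k₁ k₂))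
    (𝒜 : Type*) [Ring 𝒜] [Algebra ℂ 𝒜]
    (a ad : ℝ → Fin n → 𝒜)
    (t r : ℝ → Matrix (Fin n) (Fin n) 𝒜)
    (hZF1 : ∀ k₁ k₂ (i j : Fin n), a k₁ i * a k₂ j =
      ∑ p, ∑ q, S21 S k₂ k₁ (i, j) (p, q) • (a k₂ q * a k₁ p))
    (hZF2 : ∀ k₁ k₂ (i j : Fin n), ad k₁ i * ad k₂ j =
      ∑ p, ∑ q, S21 S k₂ k₁ (p, q) (i, j) • (ad k₂ q * ad k₁ p))
    (hE1 : ∀ k₁ k₂ (i j l : Fin n), a k₁ i * t k₂ j l =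
      ∑ q, ∑ r', ∑ s, ∑ m,
        (S21 S k₂ k₁ (i, j) (r', q) * S k₁ k₂ (r', s) (m, l)) • (t k₂ q s * a k₁ m))
    (hE2 : ∀ k₁ k₂ (i j l : Fin n), a k₁ i * r k₂ j l =
      ∑ q, ∑ r', ∑ s, ∑ m,
        (S21 S k₂ k₁ (i, j) (r', q) * S k₁ (-k₂) (r', s) (m, l)) • (r k₂ q s * a k₁ m))
    (hE3 : ∀ k₁ k₂ (i l j : Fin n), t k₁ i l * ad k₂ j =
      ∑ p, ∑ q, ∑ r', ∑ s,
        (S k₁ k₂ (i, p) (q, r') * S21 S k₂ k₁ (s, r') (l, j)) • (ad k₂ p * t k₁ q s))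
    (hE4 : ∀ k₁ k₂ (i l j : Fin n), r k₁ i l * ad k₂ j =
      ∑ p, ∑ q, ∑ r', ∑ s,
        (S k₁ k₂ (i, p) (q, r') * S21 S k₂ (-k₁) (s, r') (l, j)) • (ad k₂ p * r k₁ q s))
    (hE5 : ∀ k₁ k₂,
      emb 𝒜 (S k₁ k₂) * leg1 (t k₁) * emb 𝒜 (S21 S k₂ k₁) * leg2 (t k₂) =
        leg2 (t k₂) * emb 𝒜 (S k₁ k₂) * leg1 (t k₁) * emb 𝒜 (S21 S k₂ k₁))
    (hE6 : ∀ k₁ k₂,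
      emb 𝒜 (S k₁ k₂) * leg1 (t k₁) * emb 𝒜 (S21 S k₂ k₁) * leg2 (r k₂) =
        leg2 (r k₂) * emb 𝒜 (S k₁ (-k₂)) * leg1 (t k₁) * emb 𝒜 (S21 S (-k₂) k₁))
    (hE7 : ∀ k₁ k₂,
      emb 𝒜 (S k₁ k₂) * leg1 (r k₁) * emb 𝒜 (S21 S k₂ (-k₁)) * leg2 (r k₂) =
        leg2 (r k₂) * emb 𝒜 (S k₁ (-k₂)) * leg1 (r k₁) * emb 𝒜 (S21 S (-k₂) (-k₁)))
    (hE8 : ∀ k, t k * t k + r k * r (-k) = 1)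
    (hE9 : ∀ k, t k * r k + r k * t (-k) = 0)
    (al ald A Ad : ℝ → Fin n → 𝒜)
    (hal : ∀ k (i : Fin n), al k i = ∑ j, (t k i j * a k j + r k i j * a (-k) j))
    (hald : ∀ k (i : Fin n), ald k i = ∑ j, (ad k j * t k j i + ad (-k) j * r (-k) j i))
    (hA : ∀ k (i : Fin n), A k i = (2 : ℂ)⁻¹ • (a k i + al k i))
    (hAd : ∀ k (i : Fin n), Ad k i = (2 : ℂ)⁻¹ • (ad k i + ald k i))
    :
    ∀ k₁ k₂ (i j : Fin n),
      Ad k₁ i * Ad k₂ j = ∑ p, ∑ q, S21 S k₂ k₁ (p, q) (i, j) • (Ad k₂ q * Ad k₁ p) := by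
  have hrow : ∀ k, rowVec (ald k) = rowVec (ad k) * t k + rowVec (ad (-k)) * r (-k) := fun k => by
    rw [← rowVec_mul_add_mul, ← funext (hald k)]
  have hleg1 : ∀ k, rowLeg1 (ald k) =
      rowLeg1 (ad k) * leg1 (t k) + rowLeg1 (ad (-k)) * leg1 (r (-k)) := fun k => by
    rw [← rowLeg1_mul_leg1, ← funext (hald k)]
  have hleg2 : ∀ k, rowLeg2 (ald k) =
      rowLeg2 (ad k) * leg2 (t k) + rowLeg2 (ad (-k)) * leg2 (r (-k)) := fun k => by
    rw [← rowLeg2_mul_leg2, ← funext (hald k)]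
  have zf : ∀ k₁ k₂, rowVec (ad k₁) * rowLeg2 (ad k₂) =
      rowVec (ad k₂) * rowLeg1 (ad k₁) * emb 𝒜 (S21 S k₂ k₁) :=
    fun k₁ k₂ => (exchange_iff _ _ _).2 (hZF2 k₁ k₂)
  have te : ∀ k₁ k₂, t k₁ * rowLeg2 (ad k₂) = rowLeg2 (ad k₂) *
      (emb 𝒜 (S k₁ k₂) * (leg1 (t k₁) * emb 𝒜 (S21 S k₂ k₁))) :=
    fun k₁ k₂ => mul_rowLeg2_of_apply _ _ _ _ (hE3 k₁ k₂)
  have re : ∀ k₁ k₂, r k₁ * rowLeg2 (ad k₂) = rowLeg2 (ad k₂) *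
      (emb 𝒜 (S k₁ k₂) * (leg1 (r k₁) * emb 𝒜 (S21 S k₂ (-k₁)))) :=
    fun k₁ k₂ => mul_rowLeg2_of_apply _ _ _ _ (hE4 k₁ k₂)
  have te' : ∀ k₁ k₂, t k₁ * rowLeg1 (ad k₂) = rowLeg1 (ad k₂) *
      (emb 𝒜 (S21 S k₁ k₂) * (leg2 (t k₁) * emb 𝒜 (S k₂ k₁))) := fun k₁ k₂ => by
    have := congrArg (fun M => M.submatrix id Prod.swap) (te k₁ k₂)
    simpa only [submatrix_mul_swap, submatrix_swap_emb_S21, submatrix_swap_emb (S := S),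
      submatrix_swap_leg1, submatrix_swap_rowLeg2, submatrix_swap_mul_rowLeg2] using this
  have re' : ∀ k₁ k₂, r k₁ * rowLeg1 (ad k₂) = rowLeg1 (ad k₂) *
      (emb 𝒜 (S21 S k₁ k₂) * (leg2 (r k₁) * emb 𝒜 (S k₂ (-k₁)))) := fun k₁ k₂ => by
    have := congrArg (fun M => M.submatrix id Prod.swap) (re k₁ k₂)
    simpa only [submatrix_mul_swap, submatrix_swap_emb_S21, submatrix_swap_emb (S := S),
      submatrix_swap_leg1, submatrix_swap_rowLeg2, submatrix_swap_mul_rowLeg2] using this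
  have tt : ∀ k₁ k₂, leg1 (t k₁) * (emb 𝒜 (S21 S k₂ k₁) * leg2 (t k₂)) =
      emb 𝒜 (S21 S k₂ k₁) * (leg2 (t k₂) * (emb 𝒜 (S k₁ k₂) *
        (leg1 (t k₁) * emb 𝒜 (S21 S k₂ k₁)))) := fun k₁ k₂ =>
    eq_S21_mul_of_mul_eq hU (by simpa only [Matrix.mul_assoc] using hE5 k₁ k₂)
  have tr : ∀ k₁ k₂, leg1 (t k₁) * (emb 𝒜 (S21 S k₂ k₁) * leg2 (r k₂)) =
      emb 𝒜 (S21 S k₂ k₁) * (leg2 (r k₂) * (emb 𝒜 (S k₁ (-k₂)) *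
        (leg1 (t k₁) * emb 𝒜 (S21 S (-k₂) k₁)))) := fun k₁ k₂ =>
    eq_S21_mul_of_mul_eq hU (by simpa only [Matrix.mul_assoc] using hE6 k₁ k₂)
  have rr : ∀ k₁ k₂, leg1 (r k₁) * (emb 𝒜 (S21 S k₂ (-k₁)) * leg2 (r k₂)) =
      emb 𝒜 (S21 S k₂ k₁) * (leg2 (r k₂) * (emb 𝒜 (S k₁ (-k₂)) *
        (leg1 (r k₁) * emb 𝒜 (S21 S (-k₂) (-k₁))))) := fun k₁ k₂ =>
    eq_S21_mul_of_mul_eq hU (by simpa only [Matrix.mul_assoc] using hE7 k₁ k₂)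
  have rt : ∀ k₁ k₂, leg1 (r k₁) * (emb 𝒜 (S21 S k₂ (-k₁)) * leg2 (t k₂)) =
      emb 𝒜 (S21 S k₂ k₁) * (leg2 (t k₂) * (emb 𝒜 (S k₁ k₂) *
        (leg1 (r k₁) * emb 𝒜 (S21 S k₂ (-k₁))))) := fun k₁ k₂ => by
    have h := congrArg (fun M => M.submatrix Prod.swap Prod.swap) (hE6 k₂ k₁)
    simp only [submatrix_mul_swap, submatrix_swap_emb_S21, submatrix_swap_emb (S := S),
      submatrix_swap_leg1, submatrix_swap_leg2] at h
    have h' := congrArg (· * emb 𝒜 (S21 S k₂ (-k₁))) h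
    simpa only [Matrix.mul_assoc, emb_mul_emb_S21 hU, Matrix.mul_one] using h'.symm
  have mixed : ∀ k₁ k₂, rowVec (ald k₁) * rowLeg2 (ad k₂) =
      rowVec (ad k₂) * rowLeg1 (ald k₁) * emb 𝒜 (S21 S k₂ k₁) := fun k₁ k₂ => by
    have cancel : ∀ (k : ℝ) (X : Matrix (Fin n × Fin n) (Fin n × Fin n) 𝒜),
        rowVec (ad k) * (rowLeg2 (ad k₂) * (emb 𝒜 (S k k₂) * X)) =
          rowVec (ad k₂) * (rowLeg1 (ad k) * X) := fun k X => by
      rw [← Matrix.mul_assoc, zf, Matrix.mul_assoc, ← Matrix.mul_assoc (emb 𝒜 (S21 S k₂ k)),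
        emb_S21_mul_emb hU, Matrix.one_mul, Matrix.mul_assoc]
    simp only [hrow k₁, hleg1 k₁, Matrix.add_mul, Matrix.mul_add, Matrix.mul_assoc, te, re,
      cancel, neg_neg]
  have both : ∀ k₁ k₂, rowVec (ald k₁) * rowLeg2 (ald k₂) =
      rowVec (ald k₂) * rowLeg1 (ald k₁) * emb 𝒜 (S21 S k₂ k₁) := fun k₁ k₂ => by
    have e₁ := tt k₁ k₂
    have e₂ := rt (-k₁) k₂
    have e₃ := tr k₁ (-k₂)
    have e₄ := rr (-k₁) (-k₂)
    rw [neg_neg] at e₂ e₃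
    rw [neg_neg, neg_neg] at e₄
    have te₂ : ∀ (k l : ℝ) (X : Matrix (Fin n × Fin n) (Fin n × Fin n) 𝒜),
        t k * (rowLeg1 (ad l) * X) = rowLeg1 (ad l) *
          (emb 𝒜 (S21 S k l) * (leg2 (t k) * (emb 𝒜 (S l k) * X))) := fun k l X => by
      simp only [← Matrix.mul_assoc, te']
    have re₂ : ∀ (k l : ℝ) (X : Matrix (Fin n × Fin n) (Fin n × Fin n) 𝒜),
        r k * (rowLeg1 (ad l) * X) = rowLeg1 (ad l) *
          (emb 𝒜 (S21 S k l) * (leg2 (r k) * (emb 𝒜 (S l (-k)) * X))) := fun k l X => by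
      simp only [← Matrix.mul_assoc, re']
    rw [hleg2 k₂, Matrix.mul_add, ← Matrix.mul_assoc, ← Matrix.mul_assoc, mixed, mixed, hrow k₂,
      hleg1 k₁]
    simp only [Matrix.add_mul, Matrix.mul_add, Matrix.mul_assoc, te₂, re₂, neg_neg, e₁, e₂, e₃, e₄]
    abel
  intro k₁ k₂ i j
  have h₁ := (exchange_iff _ _ _).1 (zf k₁ k₂) i j
  have h₂ := (exchange_iff _ _ _).1 (mixed k₁ k₂) i j
  have h₃ := (exchange_iff _ _ _).1 (exchange_symm hU (mixed k₂ k₁)) i j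
  have h₄ := (exchange_iff _ _ _).1 (both k₁ k₂) i j
  simp only [hAd, smul_mul_assoc, mul_smul_comm, add_mul, mul_add, smul_add,
    Finset.sum_add_distrib, h₁, h₂, h₃, h₄, Finset.smul_sum, smul_comm _ (2 : ℂ)⁻¹]
  abel
end
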